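/- Let b be a nonnegative even integer and let k and m be positive integers with m ≥ 7. Then E_{2^m k + b} ≡ E_b + 2^m k (7(b+1)^2 - 18) (mod 2^{m+7}). -/

import Mathlib

/-- The Euler numbers `E n`, defined by `E 0 = 1`, `E (2n-1) = 0` for `n ≥ 1`,
and `∑_{r=0}^{n} C(2n, 2r) * E (2r) = 0` for `n ≥ 1`. -/
def eulerE : ℕ → ℤ
  | 0 => 1
  | 1 => 0
  | n + 2 =>
      if Even n then
        -∑ r ∈ (Finset.range (n / 2 + 1)).attach,
          ((n + 2).choose (2 * r.1) : ℤ) * eulerE (2 * r.1)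
      else 0
  decreasing_by
    have := r.2
    simp only [Finset.mem_range] at this
    omega

open Polynomial

theorem eulerE_odd (n : ℕ) : eulerE (2 * n + 1) = 0 := by
  cases n with
  | zero => simp [eulerE]
  | succ n =>
    rw [show 2 * (n + 1) + 1 = (2 * n + 1) + 2 by ring, eulerE, if_neg (by simp)]

theorem sum_choose_mul_eulerE (n : ℕ) :
    ∑ r ∈ Finset.range (n + 2), ((2 * (n + 1)).choose (2 * r) : ℤ) * eulerE (2 * r) = 0 := by
  have h : eulerE (2 * (n + 1)) =
      -∑ r ∈ Finset.range (n + 1), ((2 * (n + 1)).choose (2 * r) : ℤ) * eulerE (2 * r) := by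
    rw [show 2 * (n + 1) = 2 * n + 2 by ring, eulerE, if_pos (by simp),
      Finset.sum_attach (Finset.range (2 * n / 2 + 1))
        (fun r => ((2 * n + 2).choose (2 * r) : ℤ) * eulerE (2 * r))]
    simp
  rw [Finset.sum_range_succ, h]
  simp

/-- The linear functional on `ℤ[X]` sending `X ^ n` to the Euler number `E n`. -/
noncomputable def eulerFunctional : ℤ[X] →ₗ[ℤ] ℤ :=
  (Polynomial.basisMonomials ℤ).constr ℤ eulerE

theorem eulerFunctional_X_pow (n : ℕ) : eulerFunctional (X ^ n) = eulerE n := by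
  have := (Polynomial.basisMonomials ℤ).constr_basis ℤ eulerE n
  simpa [eulerFunctional, Polynomial.X_pow_eq_monomial] using this

theorem eulerFunctional_intCast_mul (a : ℤ) (p : ℤ[X]) :
    eulerFunctional ((a : ℤ[X]) * p) = a * eulerFunctional p := by
  rw [← zsmul_eq_mul, map_zsmul, smul_eq_mul]

theorem eulerFunctional_shift_pow (n : ℕ) :
    eulerFunctional ((X + 1) ^ n) + eulerFunctional ((X - 1) ^ n) = 2 * 0 ^ n := by
  have key : eulerFunctional ((X + 1) ^ n) + eulerFunctional ((X - 1) ^ n) =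
      ∑ k ∈ Finset.range (n + 1), (n.choose k : ℤ) * (1 + (-1) ^ (n - k)) * eulerE k := by
    rw [sub_eq_add_neg, add_pow, add_pow, map_sum, map_sum, ← Finset.sum_add_distrib]
    refine Finset.sum_congr rfl fun k _ => ?_
    rw [show (X ^ k * 1 ^ (n - k) * (n.choose k : ℤ[X])) = ((n.choose k : ℤ) : ℤ[X]) * X ^ k by
        push_cast; ring,
      show (X ^ k * (-1) ^ (n - k) * (n.choose k : ℤ[X])) =
        (((-1) ^ (n - k) * n.choose k : ℤ) : ℤ[X]) * X ^ k by push_cast; ring,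
      eulerFunctional_intCast_mul, eulerFunctional_intCast_mul, eulerFunctional_X_pow]
    ring
  rw [key]
  rcases Nat.even_or_odd' n with ⟨l, rfl | rfl⟩
  · rcases l with _ | l
    · simp [eulerE]
    · have hs : ∀ t : ℕ, ∀ f : ℕ → ℤ, (∀ i, f (2 * i + 1) = 0) →
          ∑ k ∈ Finset.range (2 * t + 1), f k = ∑ r ∈ Finset.range (t + 1), f (2 * r) := by
        intro t f hf
        induction t with
        | zero => simp
        | succ t ih =>
          rw [show 2 * (t + 1) + 1 = 2 * t + 1 + 1 + 1 by ring, Finset.sum_range_succ,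
            Finset.sum_range_succ, ih, hf, Finset.sum_range_succ _ (t + 1)]
          simp [mul_add]
      rw [hs _ _ fun i => by simp [eulerE_odd]]
      have h := congrArg (2 * ·) (sum_choose_mul_eulerE l)
      simp only [Finset.mul_sum] at h
      rw [zero_pow (by omega), mul_zero]
      rw [mul_zero] at h
      rw [← h]
      refine Finset.sum_congr rfl fun r _ => ?_
      rw [← Nat.mul_sub, pow_mul]
      norm_num
      ring
  · rw [zero_pow (by omega), mul_zero]
    refine Finset.sum_eq_zero fun k hk => ?_
    rcases Nat.even_or_odd' k with ⟨i, rfl | rfl⟩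
    · have : Odd (2 * l + 1 - 2 * i) := by
        rw [Finset.mem_range] at hk
        exact ⟨l - i, by omega⟩
      simp [this.neg_one_pow]
    · simp [eulerE_odd]

theorem eulerFunctional_shift (f : ℤ[X]) :
    eulerFunctional (f.comp (X + 1)) + eulerFunctional (f.comp (X - 1)) = 2 * f.eval 0 := by
  induction f using Polynomial.induction_on' with
  | add p q hp hq =>
    simp only [add_comp, map_add, eval_add]
    linarith
  | monomial n a =>
    have h := eulerFunctional_shift_pow n
    rw [← C_mul_X_pow_eq_monomial]
    simp only [mul_comp, C_comp, pow_comp, X_comp, eval_mul, eval_C, eval_pow, eval_X]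
    rw [show (C a : ℤ[X]) = (a : ℤ[X]) by simp, eulerFunctional_intCast_mul,
      eulerFunctional_intCast_mul]
    linear_combination a * h

/-- The product of the `n` linear factors `X - 1 + 2 s - 2 t`, `0 ≤ t < n`. -/
noncomputable def stepFactorial (n s : ℕ) : ℤ[X] :=
  ∏ t ∈ Finset.range n, (X - 1 + 2 * (s : ℤ[X]) - 2 * (t : ℤ[X]))

theorem stepFactorial_succ_succ (n s : ℕ) :
    stepFactorial (n + 1) (s + 1) = (X + 1 + 2 * (s : ℤ[X])) * stepFactorial n s := by
  rw [stepFactorial, Finset.prod_range_succ', mul_comm, stepFactorial]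
  congr 1
  · push_cast; ring
  · refine Finset.prod_congr rfl fun t _ => ?_
    push_cast; ring

theorem stepFactorial_succ (n s : ℕ) :
    stepFactorial (n + 1) s = (X - 1 + 2 * (s : ℤ[X]) - 2 * (n : ℤ[X])) * stepFactorial n s := by
  rw [stepFactorial, Finset.prod_range_succ, mul_comm, stepFactorial]

theorem eulerFunctional_stepFactorial_add (n s : ℕ) (h : s < n) :
    eulerFunctional (stepFactorial n (s + 1)) + eulerFunctional (stepFactorial n s) = 0 := by
  have key := eulerFunctional_shift
    (∏ t ∈ Finset.range n, (X + 2 * (s : ℤ[X]) - 2 * (t : ℤ[X])))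
  have h0 : (∏ t ∈ Finset.range n, (X + 2 * (s : ℤ[X]) - 2 * (t : ℤ[X]))).eval 0 = 0 := by
    rw [eval_prod]
    exact Finset.prod_eq_zero (Finset.mem_range.2 h) (by simp)
  rw [h0, mul_zero] at key
  rw [← key]
  simp only [stepFactorial, Polynomial.prod_comp]
  congr 2
  · refine Finset.prod_congr rfl fun t _ => ?_
    simp
    ring
  · refine Finset.prod_congr rfl fun t _ => ?_
    simp

theorem eulerFunctional_stepFactorial (n s : ℕ) (h : s ≤ n) :
    eulerFunctional (stepFactorial n s) = (-1) ^ (n + s) * n.factorial := by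
  have hdiff : ∀ n s, eulerFunctional (stepFactorial (n + 1) (s + 1)) =
      eulerFunctional (stepFactorial (n + 1) s) +
        2 * (n + 1) * eulerFunctional (stepFactorial n s) := by
    intro n s
    have : stepFactorial (n + 1) (s + 1) = stepFactorial (n + 1) s +
        ((2 * (n + 1) : ℤ) : ℤ[X]) * stepFactorial n s := by
      rw [stepFactorial_succ_succ, stepFactorial_succ]
      push_cast; ring
    rw [this, map_add, eulerFunctional_intCast_mul]
  induction n generalizing s with
  | zero =>
    obtain rfl : s = 0 := by omega
    have := eulerFunctional_X_pow 0
    simpa [stepFactorial, eulerE] using this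
  | succ n ih =>
    rcases s with _ | s
    · have h1 := eulerFunctional_stepFactorial_add (n + 1) 0 (by omega)
      have h2 := hdiff n 0
      have h3 := ih 0 (by omega)
      rw [Nat.factorial_succ]
      push_cast
      rw [h3] at h2
      ring_nf at h1 h2 ⊢
      linarith
    · have h1 := eulerFunctional_stepFactorial_add (n + 1) s (by omega)
      have h2 := hdiff n s
      have h3 := ih s (by omega)
      rw [Nat.factorial_succ]
      push_cast
      rw [h3] at h2
      ring_nf at h1 h2 ⊢
      linarith

/-- The value of the Euler functional at
`(X ^ 2 - 1) ^ j * ∏_{l < i} (X ^ 2 - (2 * l + 1) ^ 2)`. -/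
noncomputable def eulerMoment (j i : ℕ) : ℤ :=
  eulerFunctional ((X ^ 2 - 1) ^ j * stepFactorial (2 * i) i)

theorem eulerMoment_zero_left (i : ℕ) : eulerMoment 0 i = (-1) ^ i * (2 * i).factorial := by
  rw [eulerMoment, pow_zero, one_mul, eulerFunctional_stepFactorial _ _ (by omega), pow_add,
    pow_mul]
  simp

theorem eulerMoment_succ_left (j i : ℕ) :
    eulerMoment (j + 1) i = eulerMoment j (i + 1) + 4 * i * (i + 1) * eulerMoment j i := by
  have : (X ^ 2 - 1) ^ (j + 1) * stepFactorial (2 * i) i =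
      (X ^ 2 - 1) ^ j * stepFactorial (2 * (i + 1)) (i + 1) +
        ((4 * i * (i + 1) : ℤ) : ℤ[X]) * ((X ^ 2 - 1) ^ j * stepFactorial (2 * i) i) := by
    rw [show 2 * (i + 1) = 2 * i + 1 + 1 by ring, stepFactorial_succ_succ, stepFactorial_succ]
    push_cast; ring
  rw [eulerMoment, this, map_add, eulerFunctional_intCast_mul]
  rfl

theorem two_pow_dvd_factorial_two_mul (i : ℕ) (hi : 4 ≤ i) :
    2 ^ (i + 3) ∣ (2 * i).factorial := by
  induction i, hi using Nat.le_induction with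
  | base => decide
  | succ i _ ih =>
    rw [show 2 * (i + 1) = 2 * i + 1 + 1 by ring, Nat.factorial_succ, Nat.factorial_succ,
      show i + 1 + 3 = 1 + (i + 3) by ring, pow_add, pow_one]
    exact mul_dvd_mul ⟨i + 1, by ring⟩ (ih.mul_left _)

theorem two_pow_dvd_eulerMoment (j i : ℕ) (h : 4 ≤ i + j) :
    (2 : ℤ) ^ (i + j + 3) ∣ eulerMoment j i := by
  induction j generalizing i with
  | zero =>
    rw [eulerMoment_zero_left]
    exact Dvd.dvd.mul_left (by exact_mod_cast two_pow_dvd_factorial_two_mul i h) _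
  | succ j ih =>
    rcases Nat.lt_or_ge (i + j) 4 with h' | h'
    · obtain ⟨rfl, rfl⟩ | ⟨rfl, rfl⟩ | ⟨rfl, rfl⟩ | ⟨rfl, rfl⟩ :
          (i = 0 ∧ j = 3) ∨ (i = 1 ∧ j = 2) ∨ (i = 2 ∧ j = 1) ∨ (i = 3 ∧ j = 0) := by omega
      all_goals
        norm_num [eulerMoment_succ_left, eulerMoment_zero_left, Nat.factorial]
    · rw [eulerMoment_succ_left]
      refine dvd_add ?_ ?_
      · have := ih (i + 1) (by omega)
        rwa [show i + 1 + j + 3 = i + (j + 1) + 3 by ring] at this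
      · rw [show i + (j + 1) + 3 = 1 + (i + j + 3) by ring, pow_add]
        exact mul_dvd_mul ⟨2 * i * (i + 1), by ring⟩ (ih i h')

/-- The `j`-th forward difference of `n ↦ E (2 * n)` at `c`. -/
noncomputable def eulerDiff (c j : ℕ) : ℤ :=
  eulerFunctional ((X ^ 2 - 1) ^ j * (X ^ 2) ^ c)

theorem eulerDiff_succ (c j : ℕ) :
    eulerDiff (c + 1) j = eulerDiff c j + eulerDiff c (j + 1) := by
  rw [eulerDiff, eulerDiff, eulerDiff, ← map_add]
  congr 1
  ring

theorem eulerDiff_zero_left (j : ℕ) : eulerDiff 0 j = eulerMoment j 0 := by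
  simp [eulerDiff, eulerMoment, stepFactorial]

theorem eulerE_two_mul_add (N c : ℕ) :
    eulerE (2 * (N + c)) = ∑ j ∈ Finset.range (N + 1), (N.choose j : ℤ) * eulerDiff c j := by
  have : (X : ℤ[X]) ^ (2 * (N + c)) = ∑ j ∈ Finset.range (N + 1),
      ((N.choose j : ℤ) : ℤ[X]) * ((X ^ 2 - 1) ^ j * (X ^ 2) ^ c) := by
    rw [mul_add, pow_add, pow_mul, pow_mul]
    nth_rewrite 1 [show (X : ℤ[X]) ^ 2 = (X ^ 2 - 1) + 1 by ring]
    rw [add_pow, Finset.sum_mul]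
    refine Finset.sum_congr rfl fun j _ => ?_
    push_cast; ring
  rw [← eulerFunctional_X_pow, this, map_sum]
  simp only [eulerFunctional_intCast_mul, eulerDiff]

theorem dvd_eulerDiff_of_forall {d : ℤ} {n : ℕ} (h : ∀ j, n ≤ j → d ∣ eulerMoment j 0)
    (c j : ℕ) (hj : n ≤ j) : d ∣ eulerDiff c j := by
  induction c generalizing j with
  | zero => rw [eulerDiff_zero_left]; exact h j hj
  | succ c ih => rw [eulerDiff_succ]; exact dvd_add (ih j hj) (ih _ (by omega))

theorem two_pow_dvd_eulerDiff (c j : ℕ) (hj : 4 ≤ j) : (2 : ℤ) ^ (j + 3) ∣ eulerDiff c j :=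
  dvd_eulerDiff_of_forall (n := j) (fun i hi =>
    (pow_dvd_pow 2 (by omega)).trans (two_pow_dvd_eulerMoment i 0 (by omega))) c j le_rfl

theorem sixteen_dvd_eulerDiff_three (c : ℕ) : 16 ∣ eulerDiff c 3 := by
  refine dvd_eulerDiff_of_forall (n := 3) (fun i hi => ?_) c 3 le_rfl
  obtain rfl | hi := hi.eq_or_lt
  · norm_num [eulerMoment_succ_left, eulerMoment_zero_left, Nat.factorial]
  · exact (pow_dvd_pow (2 : ℤ) (show 4 ≤ 0 + i + 3 by omega)).trans
      (two_pow_dvd_eulerMoment i 0 (by omega))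

theorem eight_dvd_eulerDiff_two (c : ℕ) : 8 ∣ eulerDiff c 2 := by
  induction c with
  | zero =>
    norm_num [eulerDiff_zero_left, eulerMoment_succ_left, eulerMoment_zero_left, Nat.factorial]
  | succ c ih =>
    rw [eulerDiff_succ]
    exact dvd_add ih (dvd_trans (by norm_num) (sixteen_dvd_eulerDiff_three c))

/-- Twelve times the truncated logarithm `∑ (-1) ^ (l + 1) Δ ^ l / l`, `1 ≤ l ≤ 4`, of the shift,
applied to the `i`-th difference of `n ↦ E (2 * n)`. -/
noncomputable def eulerLog (c i : ℕ) : ℤ :=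
  12 * eulerDiff c (i + 1) - 6 * eulerDiff c (i + 2) + 4 * eulerDiff c (i + 3)
    - 3 * eulerDiff c (i + 4)

theorem eulerLog_succ (c i : ℕ) : eulerLog (c + 1) i = eulerLog c i + eulerLog c (i + 1) := by
  simp only [eulerLog, eulerDiff_succ]
  ring

theorem dvd_eulerLog_zero_left (i : ℕ) (hi : 3 ≤ i) : 1024 ∣ eulerLog 0 i := by
  have h : ∀ j, 7 ≤ j → (1024 : ℤ) ∣ eulerDiff 0 j := fun j hj =>
    (pow_dvd_pow (2 : ℤ) (show 10 ≤ j + 3 by omega)).trans (two_pow_dvd_eulerDiff 0 j (by omega))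
  obtain rfl | rfl | rfl | hi : i = 3 ∨ i = 4 ∨ i = 5 ∨ 6 ≤ i := by omega
  · norm_num [eulerLog, eulerDiff_zero_left, eulerMoment_succ_left, eulerMoment_zero_left,
      Nat.factorial]
  · norm_num [eulerLog, eulerDiff_zero_left, eulerMoment_succ_left, eulerMoment_zero_left,
      Nat.factorial]
  · norm_num [eulerLog, eulerDiff_zero_left, eulerMoment_succ_left, eulerMoment_zero_left,
      Nat.factorial]
  · have h1 := h (i + 1) (by omega)
    have h2 := h (i + 2) (by omega)
    have h3 := h (i + 3) (by omega)
    have h4 := h (i + 4) (by omega)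
    rw [eulerLog]
    omega

theorem dvd_eulerLog (c i : ℕ) (hi : 3 ≤ i) : 1024 ∣ eulerLog c i := by
  induction c generalizing i with
  | zero => exact dvd_eulerLog_zero_left i hi
  | succ c ih => rw [eulerLog_succ]; exact dvd_add (ih i hi) (ih _ (by omega))

theorem dvd_eulerLog_zero_sub (c : ℕ) :
    1024 ∣ eulerLog c 0 - 24 * (7 * (2 * (c : ℤ) + 1) ^ 2 - 18) := by
  have h2 : ∀ c, 1024 ∣ eulerLog c 2 - 12 * 112 := by
    intro c
    induction c with
    | zero =>
      norm_num [eulerLog, eulerDiff_zero_left, eulerMoment_succ_left, eulerMoment_zero_left,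
        Nat.factorial]
    | succ c ih =>
      have := dvd_eulerLog c (2 + 1) le_rfl
      rw [eulerLog_succ]
      omega
  have h1 : ∀ c : ℕ, 1024 ∣ eulerLog c 1 - 12 * 112 * (c + 1) := by
    intro c
    induction c with
    | zero =>
      norm_num [eulerLog, eulerDiff_zero_left, eulerMoment_succ_left, eulerMoment_zero_left,
        Nat.factorial]
    | succ c ih =>
      have := h2 c
      rw [eulerLog_succ, one_add_one_eq_two]
      push_cast
      omega
  induction c with
  | zero =>
    norm_num [eulerLog, eulerDiff_zero_left, eulerMoment_succ_left, eulerMoment_zero_left,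
      Nat.factorial]
  | succ c ih =>
    rw [eulerLog_succ]
    have h := dvd_add ih (h1 c)
    rw [zero_add]
    push_cast
    ring_nf at h ⊢
    exact h

theorem exists_odd_mul_two_pow_eq (j : ℕ) (hj : 5 ≤ j) :
    ∃ v o : ℕ, Odd o ∧ j = 2 ^ v * o ∧ v + 5 ≤ j := by
  obtain ⟨v, o, ho, h⟩ := Nat.exists_eq_two_pow_mul_odd (n := j) (by omega)
  refine ⟨v, o, ho, h, ?_⟩
  have h1 : 2 ^ v ≤ j := by rw [h]; exact Nat.le_mul_of_pos_right _ ho.pos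
  rcases Nat.lt_or_ge v 3 with hv | hv
  · interval_cases v <;> obtain ⟨q, rfl⟩ := ho <;> omega
  · refine le_trans ?_ h1
    clear h h1
    induction v, hv using Nat.le_induction with
    | base => norm_num
    | succ v _ ih => rw [pow_succ]; omega

theorem dvd_choose_mul_eulerDiff {s N : ℕ} (hN : 2 ^ s ∣ N) (c j : ℕ) (hj : 5 ≤ j) :
    (2 : ℤ) ^ (s + 8) ∣ (N.choose j : ℤ) * eulerDiff c j := by
  obtain ⟨v, o, ho, rfl, hv⟩ := exists_odd_mul_two_pow_eq j hj
  set j := 2 ^ v * o with hjdef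
  obtain ⟨w, hw⟩ := two_pow_dvd_eulerDiff c j (by omega)
  have hco : IsCoprime ((2 : ℤ) ^ (s + 8)) (o : ℤ) := by
    have : Nat.Coprime (2 ^ (s + 8)) o := (Nat.coprime_two_left.2 ho).pow_left _
    exact_mod_cast Nat.isCoprime_iff_coprime.2 this
  refine hco.dvd_of_dvd_mul_left ?_
  obtain ⟨e, he⟩ := Nat.exists_eq_add_of_le hv
  obtain ⟨q, hq⟩ := hN
  have hchoose : (N.choose j : ℤ) * (2 ^ v * o) = N * (N - 1).choose (j - 1) := by
    rcases N with _ | N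
    · simp [Nat.choose_eq_zero_of_lt (show 0 < j by omega)]
    · have := Nat.add_one_mul_choose_eq N (j - 1)
      rw [show j - 1 + 1 = j by omega] at this
      nth_rewrite 3 [hjdef] at this
      rw [Nat.add_sub_cancel]
      exact_mod_cast this.symm
  refine ⟨q * (N - 1).choose (j - 1) * 2 ^ e * w, ?_⟩
  have hq' : (N : ℤ) = 2 ^ s * q := by exact_mod_cast hq
  rw [hw, show j + 3 = v + (8 + e) by omega, pow_add, pow_add, pow_add]
  rw [hq'] at hchoose
  linear_combination (2 ^ 8 * 2 ^ e * w) * hchoose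

theorem dvd_sum_choose_mul_eulerDiff {s N : ℕ} (hs : 6 ≤ s) (hN : 2 ^ s ∣ N) (c : ℕ) :
    (2 : ℤ) ^ (s + 8) ∣ N * eulerDiff c 1 + N.choose 2 * eulerDiff c 2
      + N.choose 3 * eulerDiff c 3 + N.choose 4 * eulerDiff c 4
      - 2 * N * (7 * (2 * (c : ℤ) + 1) ^ 2 - 18) := by
  obtain ⟨w2, h2⟩ := eight_dvd_eulerDiff_two c
  obtain ⟨w3, h3⟩ := sixteen_dvd_eulerDiff_three c
  obtain ⟨w4, h4⟩ := two_pow_dvd_eulerDiff c 4 le_rfl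
  obtain ⟨z, hz⟩ := dvd_eulerLog_zero_sub c
  obtain ⟨n, hn⟩ : 64 ∣ N := (pow_dvd_pow 2 hs).trans hN
  obtain ⟨q, hq⟩ := hN
  have hn' : (N : ℤ) = 64 * n := by exact_mod_cast hn
  have hq' : (N : ℤ) = 2 ^ s * q := by exact_mod_cast hq
  have hchoose : ∀ l < 64, (N.choose (l + 1) : ℤ) * (l + 1) = N.choose l * (N - l) := by
    intro l hl
    rcases Nat.eq_zero_or_pos n with rfl | hn0
    · rcases l with _ | l <;> simp [hn]
    · have h := Nat.choose_succ_right_eq N l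
      rw [← Int.natCast_inj] at h
      push_cast [show l ≤ N by omega] at h
      exact h
  have c2 : (N.choose 2 : ℤ) * 2 = N * (N - 1) := by simpa using hchoose 1 (by norm_num)
  have c3 : (N.choose 3 : ℤ) * 3 = N.choose 2 * (N - 2) := hchoose 2 (by norm_num)
  have c4 : (N.choose 4 : ℤ) * 4 = N.choose 3 * (N - 3) := hchoose 3 (by norm_num)
  have hco : IsCoprime ((2 : ℤ) ^ (s + 8)) 3 := by
    have : Nat.Coprime (2 ^ (s + 8)) 3 := Nat.Coprime.pow_left _ (by norm_num)
    exact_mod_cast Nat.isCoprime_iff_coprime.2 this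
  refine hco.dvd_of_dvd_mul_left ?_
  simp only [eulerLog, zero_add] at hz
  norm_num at h4
  rw [h2, h3, h4] at hz ⊢
  have hz' : 3 * eulerDiff c 1 - 12 * w2 + 16 * w3 - 96 * w4
      - 6 * (7 * (2 * (c : ℤ) + 1) ^ 2 - 18) = 256 * z := by linarith
  have h : 3 * (N * eulerDiff c 1 + N.choose 2 * (8 * w2) + N.choose 3 * (16 * w3)
      + N.choose 4 * (128 * w4) - 2 * N * (7 * (2 * (c : ℤ) + 1) ^ 2 - 18)) =
      N * (256 * z + N * (12 * w2 + 8 * (N - 3) * w3 + 16 * (N ^ 2 - 6 * N + 11) * w4)) := by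
    linear_combination (12 * w2 + 8 * w3 * (N - 2) + 16 * w4 * (N - 3) * (N - 2)) * c2 +
      (16 * w3 + 32 * w4 * (N - 3)) * c3 + 96 * w4 * c4 + N * hz'
  rw [h]
  refine ⟨q * (z + n * (3 * w2 + 2 * (N - 3) * w3 + 4 * (N ^ 2 - 6 * N + 11) * w4)), ?_⟩
  rw [pow_add]
  linear_combination
    N * (12 * w2 + 8 * (N - 3) * w3 + 16 * ((N : ℤ) ^ 2 - 6 * N + 11) * w4) * hn' +
    256 * (z + n * (3 * w2 + 2 * (N - 3) * w3 + 4 * ((N : ℤ) ^ 2 - 6 * N + 11) * w4)) * hq'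

theorem stern_ext_m_ge_seven (b k m : ℕ) (hb : Even b) (hk : 0 < k) (hm : 7 ≤ m) :
    eulerE (2 ^ m * k + b) ≡
      eulerE b + 2 ^ m * k * (7 * ((b : ℤ) + 1) ^ 2 - 18) [ZMOD 2 ^ (m + 7)] := by
  obtain ⟨s, rfl⟩ : ∃ s, m = s + 1 := ⟨m - 1, by omega⟩
  obtain ⟨c, rfl⟩ := hb
  have hN : 2 ^ s ∣ 2 ^ s * k := dvd_mul_right _ _
  set N := 2 ^ s * k with hNdef
  have hN4 : 4 ≤ N := by
    have : 2 ^ 6 ≤ 2 ^ s := Nat.pow_le_pow_right (by norm_num) (by omega)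
    nlinarith
  obtain ⟨t, ht⟩ := Nat.exists_eq_add_of_le hN4
  have hE := eulerE_two_mul_add N c
  rw [show N + 1 = 5 + t by omega, Finset.sum_range_add] at hE
  have htail : (2 : ℤ) ^ (s + 8) ∣
      ∑ x ∈ Finset.range t, (N.choose (5 + x) : ℤ) * eulerDiff c (5 + x) :=
    Finset.dvd_sum fun x _ => dvd_choose_mul_eulerDiff hN c (5 + x) (by omega)
  have hhead := dvd_sum_choose_mul_eulerDiff (by omega) hN c
  have h0 : eulerDiff c 0 = eulerE (c + c) := by
    rw [eulerDiff, pow_zero, one_mul, ← pow_mul, eulerFunctional_X_pow, two_mul]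
  have hNz : (2 : ℤ) ^ (s + 1) * k = 2 * N := by rw [hNdef]; push_cast; ring
  rw [show 2 ^ (s + 1) * k + (c + c) = 2 * (N + c) by rw [hNdef]; ring, hNz]
  refine (Int.modEq_iff_dvd.2 ?_).symm
  rw [show s + 1 + 7 = s + 8 by ring, hE]
  refine (dvd_add hhead htail).trans (dvd_of_eq ?_)
  simp only [Finset.sum_range_succ, Finset.sum_range_zero, h0]
  push_cast
  simp only [Nat.choose_zero_right, Nat.choose_one_right]
  push_cast
  ring
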